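/- arXiv:1812.06541 — 7 statements merged into one kernel-verified Lean document; each statement's English description precedes it below -/
import Mathlib

section
/- An abelian group G is torsionfree (i.e., n·g = 0 with n a positive integer implies g = 0) if and only if there exists a linear (total) order on G that is compatible with the group operation (i.e., a ≤ b implies a + c ≤ b + c for all c). -/
/-- A torsion-free abelian group embeds in a group of finitely supported rational-valued functions,
through a basis of its divisible hull. -/
theorem exists_injective_addMonoidHom_finsupp_rat.{u} (G : Type u) [AddCommGroup G]
    [IsAddTorsionFree G] :
    ∃ (ι : Type u) (f : G →+ (ι →₀ ℚ)), Function.Injective f := by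
  let b := Module.Basis.ofVectorSpace ℚ (DivisibleHull G)
  exact ⟨_, b.repr.toLinearMap.toAddMonoidHom.comp (DivisibleHull.coeAddMonoidHom G),
    b.repr.injective.comp DivisibleHull.coe_injective⟩

/-- A torsion-free abelian group admits a compatible linear order, pulled back from a lexicographic
order on finitely supported rational-valued functions. -/
theorem exists_linearOrder_isOrderedAddMonoid (G : Type*) [AddCommGroup G] [IsAddTorsionFree G] :
    ∃ _ : LinearOrder G, IsOrderedAddMonoid G := by
  obtain ⟨ι, f, hf⟩ := exists_injective_addMonoidHom_finsupp_rat G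
  classical
  let _ : LinearOrder ι := linearOrderOfSTO WellOrderingRel
  have hg : Function.Injective fun x ↦ toLex (f x) := toLex.injective.comp hf
  let _ : LinearOrder G := LinearOrder.lift' (fun x ↦ toLex (f x)) hg
  exact ⟨inferInstance, Function.Injective.isOrderedAddMonoid (fun x ↦ toLex (f x))
    (fun x y ↦ by simp) Iff.rfl⟩

/-- An abelian group `G` is torsionfree (`n • g = 0` with `n` a positive natural number implies
`g = 0`) if and only if there exists a linear (total) order on `G` compatible with the group
operation (`a ≤ b` implies `a + c ≤ b + c`). -/
theorem torsionfree_iff_exists_compatible_linearOrder {G : Type*} [AddCommGroup G] :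
    (∀ (n : ℕ) (g : G), 0 < n → n • g = 0 → g = 0) ↔
      ∃ r : LinearOrder G, ∀ a b c : G, r.le a b → r.le (a + c) (b + c) := by
  constructor
  · intro h
    have : IsAddTorsionFree G := ⟨fun n hn a b hab ↦ sub_eq_zero.mp <|
      h n (a - b) (Nat.pos_of_ne_zero hn) (by simpa [smul_sub, sub_eq_zero] using hab)⟩
    obtain ⟨r, hr⟩ := exists_linearOrder_isOrderedAddMonoid G
    exact ⟨r, fun a b c hab ↦ add_le_add_left hab c⟩
  · rintro ⟨r, hr⟩ n g hn hg
    have : IsOrderedAddMonoid G := { add_le_add_left := fun a b hab c ↦ hr a b c hab }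
    exact (nsmul_eq_zero_iff_right hn.ne').mp hg
end

section
/- Let G be a torsionfree abelian group and R a G-graded commutative ring. If 𝔭 is a prime ideal of R, then 𝔭*, the ideal generated by all homogeneous elements of 𝔭, is a G-graded prime ideal contained in 𝔭. -/
open SetLike in
/-- A proper homogeneous ideal of a ring graded by a monoid with unique sums is prime as soon as
it satisfies the primality condition on homogeneous elements. -/
theorem Ideal.IsHomogeneous.isPrime_of_homogeneous_mem_or_mem_of_uniqueSums
    {ι σ A : Type*} [CommRing A] [AddMonoid ι] [DecidableEq ι] [UniqueSums ι]
    [SetLike σ A] [AddSubmonoidClass σ A] {𝒜 : ι → σ} [GradedRing 𝒜] {I : Ideal A}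
    (hI : I.IsHomogeneous 𝒜) (I_ne_top : I ≠ ⊤)
    (mem_or_mem : ∀ {x y : A}, IsHomogeneousElem 𝒜 x → IsHomogeneousElem 𝒜 y →
      x * y ∈ I → x ∈ I ∨ y ∈ I) :
    I.IsPrime := by
  classical
  refine ⟨I_ne_top, fun {x y} hxy ↦ ?_⟩
  by_contra! ⟨hx, hy⟩
  let s (z : A) : Finset ι :=
    {i ∈ (DirectSum.decompose 𝒜 z).support | (DirectSum.decompose 𝒜 z i : A) ∉ I}
  have s_nonempty {z : A} (hz : z ∉ I) : (s z).Nonempty := by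
    rw [Finset.filter_nonempty_iff]
    contrapose! hz
    rw [← DirectSum.sum_support_decompose 𝒜 z]
    exact I.sum_mem hz
  obtain ⟨a, ha, b, hb, hab⟩ :=
    UniqueSums.uniqueAdd_of_nonempty (s_nonempty hx) (s_nonempty hy)
  obtain ⟨ha, haI⟩ := Finset.mem_filter.mp ha
  obtain ⟨hb, hbI⟩ := Finset.mem_filter.mp hb
  have hsum : (DirectSum.decompose 𝒜 (x * y) (a + b) : A) ∈ I := hI _ hxy
  rw [DirectSum.decompose_mul, DirectSum.coe_mul_apply,
    ← Finset.add_sum_erase (a := (a, b)) _ _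
      (by exact Finset.mem_filter.mpr ⟨Finset.mk_mem_product ha hb, rfl⟩),
    I.add_mem_iff_left] at hsum
  · exact (mem_or_mem ⟨a, SetLike.coe_mem _⟩ ⟨b, SetLike.coe_mem _⟩ hsum).elim haI hbI
  · refine I.sum_mem fun ⟨i, j⟩ hij ↦ ?_
    simp only [Finset.mem_erase, ne_eq, Prod.mk.injEq, Finset.mem_filter,
      Finset.mem_product] at hij
    obtain ⟨hne, ⟨hi, hj⟩, hadd⟩ := hij
    by_cases hiI : (DirectSum.decompose 𝒜 x i : A) ∈ I
    · exact I.mul_mem_right _ hiI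
    by_cases hjI : (DirectSum.decompose 𝒜 y j : A) ∈ I
    · exact I.mul_mem_left _ hjI
    exact absurd (hab (Finset.mem_filter.mpr ⟨hi, hiI⟩) (Finset.mem_filter.mpr ⟨hj, hjI⟩) hadd) hne

/-- A torsion-free abelian group has unique sums, since it embeds into a `ℚ`-vector space. -/
theorem UniqueSums.of_isAddTorsionFree (G : Type*) [AddCommGroup G] [IsAddTorsionFree G] :
    UniqueSums G :=
  .of_injective_addHom (DivisibleHull.coeAddMonoidHom G).toAddHom DivisibleHull.coe_injective
    inferInstance


/-- Let `G` be a torsionfree abelian group and `R` a `G`-graded commutative ring.  If `𝔭` is a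
prime ideal of `R`, then `𝔭*` (the ideal generated by all the homogeneous elements of `𝔭`, i.e.
`Ideal.homogeneousCore 𝒜 𝔭`) is a `G`-graded prime ideal contained in `𝔭`. -/
theorem homogeneousCore_isPrime_of_isPrime
    {G R : Type*} [AddCommGroup G] [DecidableEq G] [CommRing R]
    (𝒜 : G → AddSubgroup R) [GradedRing 𝒜]
    (hG : ∀ (n : ℕ) (g : G), 0 < n → n • g = 0 → g = 0)
    (𝔭 : Ideal R) (h𝔭 : 𝔭.IsPrime) :
    Ideal.IsHomogeneous 𝒜 (𝔭.homogeneousCore 𝒜).toIdeal ∧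
      (𝔭.homogeneousCore 𝒜).toIdeal.IsPrime ∧ (𝔭.homogeneousCore 𝒜).toIdeal ≤ 𝔭 := by
  have : IsAddTorsionFree G := ⟨fun n hn a b hab ↦ sub_eq_zero.mp <|
    hG n _ (Nat.pos_of_ne_zero hn) (by rw [nsmul_sub, sub_eq_zero]; exact hab)⟩
  have := UniqueSums.of_isAddTorsionFree G
  have hle := 𝔭.toIdeal_homogeneousCore_le 𝒜
  have hhom := (𝔭.homogeneousCore 𝒜).isHomogeneous
  refine ⟨hhom, hhom.isPrime_of_homogeneous_mem_or_mem_of_uniqueSums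
    (ne_top_of_le_ne_top h𝔭.ne_top hle) fun hx hy hxy ↦ ?_, hle⟩
  exact (h𝔭.mem_or_mem (hle hxy)).imp (Ideal.mem_homogeneousCore_of_homogeneous_of_mem hx)
    (Ideal.mem_homogeneousCore_of_homogeneous_of_mem hy)
end

section
/- Let G be a torsionfree abelian group and R a G-graded commutative ring. Every G-graded maximal ideal 𝔪 of R, i.e., every G-graded ideal maximal with respect to inclusion among proper G-graded ideals of R, is a prime ideal of R. -/
/-- Every torsionfree abelian group has a compatible linear order. -/
theorem IsAddTorsionFree.exists_linearOrder_isOrderedCancelAddMonoid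
    (G : Type*) [AddCommGroup G] [IsAddTorsionFree G] :
    ∃ _ : LinearOrder G, IsOrderedCancelAddMonoid G := by
  let b := Module.Basis.ofVectorSpace ℚ (DivisibleHull G)
  let _ : LinearOrder (Module.Basis.ofVectorSpaceIndex ℚ (DivisibleHull G)) :=
    IsWellOrder.linearOrder WellOrderingRel
  let f : G → Lex (Module.Basis.ofVectorSpaceIndex ℚ (DivisibleHull G) →₀ ℚ) :=
    fun g ↦ toLex (b.repr (g : DivisibleHull G))
  have hf : Function.Injective f :=
    toLex.injective.comp (b.repr.injective.comp DivisibleHull.coe_injective)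
  have hadd (x y : G) : f (x + y) = f x + f y := by
    simp [f, DivisibleHull.coe_add]
  let _ : LinearOrder G := LinearOrder.lift' f hf
  have hle {x y : G} : x ≤ y ↔ f x ≤ f y := Iff.rfl
  have : IsOrderedAddMonoid G :=
    { add_le_add_left := fun x y h z ↦ by
        rw [hle, hadd, hadd]
        exact add_le_add_left (hle.1 h) (f z) }
  exact ⟨inferInstance, inferInstance⟩

/-- An ideal maximal among proper homogeneous ideals contains one factor of every product of a
homogeneous element with an arbitrary element that lies in it. -/
theorem Ideal.mem_or_mem_of_maximal_isHomogeneous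
    {ι R : Type*} [AddCommMonoid ι] [DecidableEq ι] [CommRing R]
    (𝒜 : ι → AddSubgroup R) [GradedRing 𝒜] {𝔪 : Ideal R} (h𝔪 : 𝔪.IsHomogeneous 𝒜)
    (hmax : ∀ I : Ideal R, I.IsHomogeneous 𝒜 → 𝔪 < I → I = ⊤)
    {x y : R} (hx : SetLike.IsHomogeneousElem 𝒜 x) (hxy : x * y ∈ 𝔪) :
    x ∈ 𝔪 ∨ y ∈ 𝔪 := by
  refine or_iff_not_imp_left.2 fun hx𝔪 ↦ ?_
  have hspan : (Ideal.span {x}).IsHomogeneous 𝒜 :=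
    Ideal.homogeneous_span 𝒜 {x} fun z hz ↦ by rwa [Set.mem_singleton_iff.1 hz]
  have htop : 𝔪 ⊔ Ideal.span {x} = ⊤ :=
    hmax _ (h𝔪.sup hspan) <| left_lt_sup.2 fun h ↦
      hx𝔪 (h (Ideal.mem_span_singleton_self x))
  obtain ⟨a, ha, c, hc, hac⟩ := Submodule.mem_sup.1 ((Ideal.eq_top_iff_one _).1 htop)
  obtain ⟨r, rfl⟩ := Ideal.mem_span_singleton'.1 hc
  have hy : y = y * a + r * (x * y) := by linear_combination -y * hac
  rw [hy]
  exact 𝔪.add_mem (𝔪.mul_mem_left y ha) (𝔪.mul_mem_left r hxy)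

/-- Let `G` be a torsionfree abelian group and `R` a `G`-graded commutative ring.  Every `G`-graded
maximal ideal `𝔪` of `R` (i.e. every `G`-graded ideal maximal with respect to inclusion among
proper `G`-graded ideals) is a prime ideal of `R`. -/
theorem graded_maximal_isPrime
    {G R : Type*} [AddCommGroup G] [DecidableEq G] [CommRing R]
    (𝒜 : G → AddSubgroup R) [GradedRing 𝒜]
    (hG : ∀ (n : ℕ) (g : G), 0 < n → n • g = 0 → g = 0)
    (𝔪 : Ideal R) (h𝔪 : Ideal.IsHomogeneous 𝒜 𝔪) (hproper : 𝔪 ≠ ⊤)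
    (hmax : ∀ I : Ideal R, Ideal.IsHomogeneous 𝒜 I → 𝔪 < I → I = ⊤) :
    𝔪.IsPrime := by
  have : IsAddTorsionFree G :=
    ⟨fun n hn x y hxy ↦ sub_eq_zero.1 <| hG n _ (Nat.pos_of_ne_zero hn) <| by
      rw [nsmul_sub, sub_eq_zero]
      exact hxy⟩
  obtain ⟨_, _⟩ := IsAddTorsionFree.exists_linearOrder_isOrderedCancelAddMonoid G
  obtain rfl : ‹DecidableEq G› = LinearOrder.toDecidableEq := Subsingleton.elim _ _
  exact h𝔪.isPrime_of_homogeneous_mem_or_mem hproper fun hx _ hxy ↦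
    Ideal.mem_or_mem_of_maximal_isHomogeneous 𝒜 h𝔪 hmax hx hxy
end

section
/- Let R be a commutative Noetherian ring, 𝔭 a prime ideal of R, M a finitely generated R-module, and N a submodule of M which is 𝔭-primary in M (i.e., the unique associated prime of M/N is 𝔭). Then N is irreducible in M if and only if the localization N_𝔭 is irreducible in M_𝔭 as an R_𝔭-submodule. -/
/-- A submodule `N` of `M` is irreducible if whenever `N₁ ⊓ N₂ = N` for submodules `N₁, N₂` of
`M`, then `N₁ = N` or `N₂ = N`. -/
def SubmoduleIrreducible {R M : Type*} [Semiring R] [AddCommMonoid M] [Module R M]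
    (N : Submodule R M) : Prop :=
  ∀ N₁ N₂ : Submodule R M, N₁ ⊓ N₂ = N → N₁ = N ∨ N₂ = N

/-- If `𝔭` is the unique associated prime of `M ⧸ N`, then elements outside `𝔭` act injectively
on `M ⧸ N`. -/
theorem Submodule.mem_of_smul_mem_of_associatedPrimes_eq_singleton
    {R M : Type*} [CommRing R] [IsNoetherianRing R] [AddCommGroup M] [Module R M]
    {𝔭 : Ideal R} {N : Submodule R M} (hN : associatedPrimes R (M ⧸ N) = {𝔭})
    {r : R} (hr : r ∉ 𝔭) {m : M} (h : r • m ∈ N) : m ∈ N := by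
  by_contra hm
  have hzero := biUnion_associatedPrimes_eq_zero_divisors R (M ⧸ N)
  rw [hN, Set.biUnion_singleton] at hzero
  have : r ∈ (𝔭 : Set R) := by
    rw [hzero]
    refine ⟨N.mkQ m, by simpa using hm, ?_⟩
    rw [← map_smul]
    exact (Submodule.Quotient.mk_eq_zero N).2 h
  exact hr this

/-- A submodule on whose quotient every element of `S` acts injectively is the contraction of its
localization at `S`. -/
theorem Submodule.comap_localized_eq_self
    {R M : Type*} [CommRing R] [AddCommGroup M] [Module R M] (S : Submonoid R) (N : Submodule R M)
    (hN : ∀ s ∈ S, ∀ m : M, s • m ∈ N → m ∈ N) :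
    ((N.localized S).restrictScalars R).comap (LocalizedModule.mkLinearMap S M) = N := by
  refine le_antisymm ?_ ((Submodule.localized'gi (Localization S) S
    (LocalizedModule.mkLinearMap S M)).gc.le_u_l N)
  rintro m ⟨n, hn, s, hns⟩
  rw [← IsLocalizedModule.mk'_one S, IsLocalizedModule.mk'_eq_mk'_iff] at hns
  obtain ⟨t, ht⟩ := hns
  refine hN _ (t * s).2 m ?_
  rw [one_smul, ← mul_smul] at ht
  change (t * s) • m ∈ N
  rw [ht]
  exact N.smul_of_tower_mem t hn

/-- Let `R` be a commutative Noetherian ring, `𝔭` a prime ideal of `R`, `M` a finitely generated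
`R`-module and `N` a submodule of `M` which is `𝔭`-primary in `M` (the set of associated primes of
`M/N` is exactly `{𝔭}`).  Then `N` is irreducible in `M` if and only if the localization `N_𝔭` is
irreducible in `M_𝔭` as an `R_𝔭`-submodule. -/
theorem submoduleIrreducible_iff_localized_irreducible
    {R M : Type*} [CommRing R] [IsNoetherianRing R]
    [AddCommGroup M] [Module R M] [Module.Finite R M]
    (𝔭 : Ideal R) (h𝔭 : 𝔭.IsPrime) (N : Submodule R M)
    (hN : associatedPrimes R (M ⧸ N) = {𝔭}) :
    SubmoduleIrreducible N ↔ SubmoduleIrreducible (N.localized 𝔭.primeCompl) := by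
  have hcontr := N.comap_localized_eq_self 𝔭.primeCompl fun s hs m h ↦
    Submodule.mem_of_smul_mem_of_associatedPrimes_eq_singleton hN hs h
  let gi := Submodule.localized'gi (Localization 𝔭.primeCompl) 𝔭.primeCompl
    (LocalizedModule.mkLinearMap 𝔭.primeCompl M)
  constructor
  · intro h P₁ P₂ hP
    refine (h _ _ ((gi.gc.u_inf (b₁ := P₁) (b₂ := P₂)).symm.trans ?_)).imp
      (fun e ↦ ?_) (fun e ↦ ?_)
    · rw [hP]
      exact hcontr
    · exact (gi.l_u_eq P₁).symm.trans (congrArg _ e)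
    · exact (gi.l_u_eq P₂).symm.trans (congrArg _ e)
  · intro h N₁ N₂ hN'
    have eq_of_localized_eq {K : Submodule R M} (hK : N ≤ K)
        (e : K.localized 𝔭.primeCompl = N.localized 𝔭.primeCompl) : K = N := by
      refine le_antisymm ?_ hK
      rw [← hcontr, ← e]
      exact gi.gc.le_u_l K
    refine (h _ _ ((Submodule.localized'_inf ..).symm.trans (congrArg _ hN'))).imp
      (eq_of_localized_eq (hN' ▸ inf_le_left)) (eq_of_localized_eq (hN' ▸ inf_le_right))
end

section
/- Let k₀ be a field and G an abelian group (not necessarily torsionfree). The group algebra k₀[G] is a Noetherian ring if and only if G is finitely generated. -/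
namespace AddMonoidAlgebra

variable (R : Type*) {G : Type*} [CommRing R] [AddCommGroup G]

/-- The kernel of the ring homomorphism `R[G] → R[G ⧸ H]` induced by the quotient map. -/
noncomputable def quotientKer (H : Submodule ℤ G) : Ideal (AddMonoidAlgebra R G) :=
  RingHom.ker (mapDomainRingHom R H.mkQ.toAddMonoidHom)

theorem single_sub_one_mem_quotientKer_iff [Nontrivial R] (H : Submodule ℤ G) (g : G) :
    (single g 1 - 1 : AddMonoidAlgebra R G) ∈ quotientKer R H ↔ g ∈ H := by
  rw [quotientKer, RingHom.mem_ker, map_sub, map_one, sub_eq_zero, mapDomainRingHom_apply,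
    mapDomain_single, one_def, ← Submodule.Quotient.mk_eq_zero H]
  refine ⟨fun h => ?_, fun h => ?_⟩
  · exact of_injective (R := R) h
  · exact congrArg (single · (1 : R)) h

theorem quotientKer_mono : Monotone (quotientKer R (G := G)) := by
  intro H K h x hx
  have key : mapDomainRingHom R K.mkQ.toAddMonoidHom =
      (mapDomainRingHom R (Submodule.factor h).toAddMonoidHom).comp
        (mapDomainRingHom R H.mkQ.toAddMonoidHom) := by
    rw [← mapDomainRingHom_comp]
    rfl
  rw [quotientKer, RingHom.mem_ker] at hx ⊢
  rw [key, RingHom.comp_apply, hx, map_zero]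

theorem quotientKer_injective [Nontrivial R] :
    Function.Injective (quotientKer R (G := G)) := by
  intro H K h
  ext g
  rw [← single_sub_one_mem_quotientKer_iff R, h, single_sub_one_mem_quotientKer_iff R]

/-- An abelian group whose group algebra over a nontrivial ring is Noetherian is finitely
generated. -/
theorem addGroup_fg_of_isNoetherianRing [Nontrivial R]
    [IsNoetherianRing (AddMonoidAlgebra R G)] : AddGroup.FG G := by
  have hmono : StrictMono (quotientKer R (G := G)) :=
    (quotientKer_mono R).strictMono_of_injective (quotientKer_injective R)
  have : IsNoetherian ℤ G := isNoetherian_iff'.mpr hmono.wellFoundedGT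
  exact Module.Finite.iff_addGroup_fg.mp inferInstance

end AddMonoidAlgebra

/-- Let `k₀` be a field and `G` an abelian group (not necessarily torsionfree).  The group
algebra `k₀[G]` is a Noetherian ring if and only if `G` is finitely generated. -/
theorem groupAlgebra_isNoetherianRing_iff_fg
    {k₀ G : Type*} [Field k₀] [AddCommGroup G] :
    IsNoetherianRing (AddMonoidAlgebra k₀ G) ↔ AddGroup.FG G := by
  refine ⟨fun _ => AddMonoidAlgebra.addGroup_fg_of_isNoetherianRing k₀, fun h => ?_⟩
  have := AddMonoidAlgebra.finiteType_iff_group_fg (R := k₀).mpr h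
  exact Algebra.FiniteType.isNoetherianRing k₀ _
end

section
/- Let k₀ be a field and G an abelian group which is not finitely generated. Then the augmentation ideal J of the group algebra k₀[G], i.e., the kernel of the k₀-algebra map π : k₀[G] → k₀ sending Σ aᵢe_{gᵢ} to Σ aᵢ, is not a finitely generated ideal. -/
/-- Modulo a subgroup containing its support, an element of a group algebra becomes a constant,
equal to its augmentation. -/
theorem AddMonoidAlgebra.mapDomainRingHom_mk_eq_single_zero
    {k G : Type*} [Semiring k] [AddCommGroup G] (π : AddMonoidAlgebra k G →+* k)
    (hπ : ∀ (g : G) (a : k), π (AddMonoidAlgebra.single g a) = a)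
    (H : AddSubgroup G) (x : AddMonoidAlgebra k G) (hx : ∀ g ∈ x.coeff.support, g ∈ H) :
    AddMonoidAlgebra.mapDomainRingHom k (QuotientAddGroup.mk' H) x =
      AddMonoidAlgebra.single 0 (π x) := by
  have h_sum : x = ∑ g ∈ x.coeff.support, AddMonoidAlgebra.single g (x.coeff g) :=
    (AddMonoidAlgebra.sum_coeff_single x).symm
  have h_aug : π x = ∑ g ∈ x.coeff.support, x.coeff g := by
    conv_lhs => rw [h_sum]
    simp only [map_sum, hπ]
  rw [h_aug, ← AddMonoidAlgebra.singleAddHom_apply, map_sum]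
  conv_lhs => rw [h_sum]
  rw [map_sum]
  refine Finset.sum_congr rfl fun g hg => ?_
  have h_zero : QuotientAddGroup.mk' H g = 0 := (QuotientAddGroup.eq_zero_iff g).mpr (hx g hg)
  rw [AddMonoidAlgebra.mapDomainRingHom_apply, AddMonoidAlgebra.mapDomain_single, h_zero,
    AddMonoidAlgebra.singleAddHom_apply]

/-- Let `k₀` be a field and `G` an abelian group which is not finitely generated.  Then the
augmentation ideal of the group algebra `k₀[G]`, i.e. the kernel of the ring homomorphism
`π : k₀[G] → k₀` sending `Σ aᵢ e_{gᵢ}` to `Σ aᵢ` (i.e. `π (a e_g) = a` for every `g ∈ G` and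
`a ∈ k₀`), is not a finitely generated ideal. -/
theorem augmentation_ideal_not_fg
    {k₀ G : Type*} [Field k₀] [AddCommGroup G] (hG : ¬ AddGroup.FG G)
    (π : AddMonoidAlgebra k₀ G →+* k₀)
    (hπ : ∀ (g : G) (a : k₀), π (AddMonoidAlgebra.single g a) = a) :
    ¬ (RingHom.ker π).FG := by
  classical
  rintro ⟨S, hS⟩
  apply hG
  let T : Finset G := S.biUnion fun x => x.coeff.support
  let H : AddSubgroup G := AddSubgroup.closure (T : Set G)
  let φ := AddMonoidAlgebra.mapDomainRingHom k₀ (QuotientAddGroup.mk' H)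
  have h_le : RingHom.ker π ≤ RingHom.ker φ := by
    conv_lhs => rw [← hS]
    refine Ideal.span_le.mpr fun x hx => ?_
    have h_ker : π x = 0 := by
      rw [← RingHom.mem_ker, ← hS]
      exact Ideal.subset_span hx
    refine RingHom.mem_ker.mpr ?_
    rw [AddMonoidAlgebra.mapDomainRingHom_mk_eq_single_zero π hπ H x fun g hg =>
      AddSubgroup.subset_closure (Finset.mem_biUnion.mpr ⟨x, hx, hg⟩), h_ker]
    exact AddMonoidAlgebra.single_zero 0
  refine AddGroup.fg_iff.mpr ⟨T, (AddSubgroup.eq_top_iff' H).mpr fun g => ?_, T.finite_toSet⟩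
  have h_mem : AddMonoidAlgebra.single g (1 : k₀) - AddMonoidAlgebra.single 0 1 ∈ RingHom.ker φ :=
    h_le (by rw [RingHom.mem_ker, map_sub, hπ, hπ, sub_self])
  rw [RingHom.mem_ker, map_sub, sub_eq_zero, AddMonoidAlgebra.mapDomainRingHom_apply,
    AddMonoidAlgebra.mapDomainRingHom_apply, AddMonoidAlgebra.mapDomain_single,
    AddMonoidAlgebra.mapDomain_single, map_zero] at h_mem
  exact (QuotientAddGroup.eq_zero_iff g).mp
    (AddMonoidAlgebra.single_left_injective one_ne_zero h_mem)
end

section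
/- Let R be a commutative Noetherian ring and I a radical ideal of R that is not R itself. Then the index of reducibility of I equals the number of minimal primes of I: ir_R(I) = |Min(I)|. -/
/-- The index of reducibility of `N` in `M`: the least `r` such that `N` is an intersection of
`r` irreducible submodules of `M`. -/
noncomputable def irIndex {R M : Type*} [Semiring R] [AddCommMonoid M] [Module R M]
    (N : Submodule R M) : ℕ :=
  sInf {r : ℕ | ∃ f : Fin r → Submodule R M,
    (∀ i, SubmoduleIrreducible (f i)) ∧ N = ⨅ i, f i}

theorem SubmoduleIrreducible.infIrred {R M : Type*} [Semiring R] [AddCommMonoid M] [Module R M]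
    {N : Submodule R M} (hN : SubmoduleIrreducible N) (htop : N ≠ ⊤) : InfIrred N :=
  ⟨fun h => htop (isMax_iff_eq_top.mp h), fun {b c} h => hN b c h⟩

theorem Ideal.IsPrime.submoduleIrreducible {R : Type*} [CommRing R] {P : Ideal R}
    (hP : P.IsPrime) : SubmoduleIrreducible (P : Submodule R R) := by
  intro J K h
  rcases hP.inf_le.mp (le_of_eq h) with hJ | hK
  · exact Or.inl (le_antisymm hJ (h ▸ inf_le_left))
  · exact Or.inr (le_antisymm hK (h ▸ inf_le_right))

/-- An irreducible ideal containing `I` and contained in a minimal prime `P` of `I` has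
radical `P`. -/
theorem SubmoduleIrreducible.radical_eq_of_le_minimalPrime {R : Type*} [CommRing R]
    [IsNoetherianRing R] {I J P : Ideal R} (hJ : SubmoduleIrreducible (J : Submodule R R))
    (hIJ : I ≤ J) (hJP : J ≤ P) (hP : P ∈ I.minimalPrimes) : J.radical = P := by
  have hPp : P.IsPrime := hP.1.1
  have htop : J ≠ ⊤ := fun h => hPp.ne_top (top_le_iff.mp (h ▸ hJP))
  have hprim : J.IsPrimary := (hJ.infIrred htop).isPrimary
  have hle : J.radical ≤ P := hPp.radical_le_iff.mpr hJP
  exact le_antisymm hle (hP.2 ⟨Ideal.isPrime_radical hprim, hIJ.trans J.le_radical⟩ hle)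

/-- Let `R` be a commutative Noetherian ring and `I` a proper radical ideal of `R`.  Then the
index of reducibility of `I` equals the number of minimal primes of `I`:
`ir_R(I) = |Min(I)|`. -/
theorem irIndex_eq_ncard_minimalPrimes
    {R : Type*} [CommRing R] [IsNoetherianRing R]
    (I : Ideal R) (hrad : I.radical = I) (hproper : I ≠ ⊤) :
    irIndex (I : Submodule R R) = I.minimalPrimes.ncard := by
  have hfin : I.minimalPrimes.Finite := I.finite_minimalPrimes_of_isNoetherianRing R
  have : Finite I.minimalPrimes := hfin
  refine IsLeast.csInf_eq ⟨?_, ?_⟩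
  · let e : I.minimalPrimes ≃ Fin I.minimalPrimes.ncard := Finite.equivFin I.minimalPrimes
    refine ⟨fun i => (e.symm i : Ideal R),
      fun i => (e.symm i).2.1.1.submoduleIrreducible, ?_⟩
    rw [e.symm.iInf_comp (g := fun P : I.minimalPrimes => (P : Ideal R)), ← sInf_eq_iInf',
      Ideal.sInf_minimalPrimes, hrad]
  · rintro r ⟨f, hf, hI⟩
    have hex (P : I.minimalPrimes) : ∃ i, f i ≤ (P : Ideal R) := by
      have hle : Finset.univ.inf f ≤ (P : Ideal R) := by
        rw [Finset.inf_univ_eq_iInf, ← hI]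
        exact P.2.1.2
      obtain ⟨i, -, hi⟩ := P.2.1.1.inf_le'.mp hle
      exact ⟨i, hi⟩
    choose g hg using hex
    have hgrad (P : I.minimalPrimes) : Ideal.radical (f (g P)) = P :=
      (hf _).radical_eq_of_le_minimalPrime (hI.trans_le (iInf_le f _)) (hg P) P.2
    have hinj : Function.Injective g := fun P Q h =>
      Subtype.ext (by rw [← hgrad P, ← hgrad Q, h])
    simpa using Nat.card_le_card_of_injective g hinj
end
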